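/- Let X be a Markov chain on E with transition kernel P and n-step transition probabilities P_n(x,·). Assume that for every pair x, y ∈ E there exists n = n_{x,y} ∈ ℕ such that the measures P_n(x,·) and P_n(y,·) are not mutually singular. Then X has at most one invariant probability measure, and if an invariant probability measure μ exists, then for μ-almost all x ∈ E the total variation distance ‖P_n(x,·) − μ‖ tends to 0 as n → ∞. -/

import Mathlib

open MeasureTheory ProbabilityTheory Filter ENNReal

/-- The total variation distance `‖μ - ν‖` between two (probability) measures,
with values in `[0,2]`: `‖μ - ν‖ = 2 ⨆_{A measurable} |μ A - ν A|`. -/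
noncomputable def tvDist {E : Type*} [MeasurableSpace E] (μ ν : Measure E) : ℝ≥0∞ :=
  2 * ⨆ (A : Set E) (_ : MeasurableSet A), ((μ A - ν A) ⊔ (ν A - μ A))

/-- The `n`-step transition kernel `P_n` of a Markov kernel `P`. -/
noncomputable def nStep {E : Type*} [MeasurableSpace E] (P : ProbabilityTheory.Kernel E E) :
    ℕ → ProbabilityTheory.Kernel E E
  | 0 => ProbabilityTheory.Kernel.id
  | n + 1 => (nStep P n) ∘ₖ P

open scoped symmDiff

section SetGap

variable {E : Type*} [MeasurableSpace E]

/-- The largest excess of `μ` over `ν` on the members of a family `𝒞` of sets. -/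
noncomputable def setGap (𝒞 : Set (Set E)) (μ ν : Measure E) : ℝ≥0∞ :=
  ⨆ A ∈ 𝒞, (μ A - ν A)

lemma measure_le_add_setGap {𝒞 : Set (Set E)} (μ ν : Measure E) {A : Set E} (hA : A ∈ 𝒞) :
    μ A ≤ ν A + setGap 𝒞 μ ν :=
  tsub_le_iff_left.1 (le_iSup₂ (f := fun A (_ : A ∈ 𝒞) => μ A - ν A) A hA)

lemma setGap_le_iff {𝒞 : Set (Set E)} {μ ν : Measure E} {c : ℝ≥0∞} :
    setGap 𝒞 μ ν ≤ c ↔ ∀ A ∈ 𝒞, μ A ≤ ν A + c := by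
  simp only [setGap, iSup_le_iff, tsub_le_iff_left]

lemma setGap_self (𝒞 : Set (Set E)) (μ : Measure E) : setGap 𝒞 μ μ = 0 := by
  simpa using (setGap_le_iff (𝒞 := 𝒞) (μ := μ) (ν := μ) (c := 0)).2 (by simp)

lemma setGap_le_one (𝒞 : Set (Set E)) (μ ν : Measure E) [IsProbabilityMeasure μ] :
    setGap 𝒞 μ ν ≤ 1 :=
  setGap_le_iff.2 fun _ _ => prob_le_one.trans le_add_self

lemma measurable_setGap {𝒞 : Set (Set E)} (h𝒞 : 𝒞.Countable)
    (hm : ∀ A ∈ 𝒞, MeasurableSet A) (Q : Kernel E E) :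
    Measurable fun p : E × E => setGap 𝒞 (Q p.1) (Q p.2) :=
  Measurable.biSup 𝒞 h𝒞 fun A hA =>
    ((Q.measurable_coe (hm A hA)).comp measurable_fst).sub
      ((Q.measurable_coe (hm A hA)).comp measurable_snd)

/-- Taking suprema over a generating algebra gives the same value as over all measurable sets. -/
lemma measure_le_add_setGap_of_measurableSet {𝒞 : Set (Set E)} (hC : IsSetAlgebra 𝒞)
    (hgen : ‹MeasurableSpace E› = MeasurableSpace.generateFrom 𝒞) (μ ν : Measure E)
    [IsFiniteMeasure μ] [IsFiniteMeasure ν] {A : Set E} (hA : MeasurableSet A) :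
    μ A ≤ ν A + setGap 𝒞 μ ν := by
  refine ENNReal.le_of_forall_pos_le_add fun ε hε _ => ?_
  obtain ⟨B, hB, hAB⟩ :=
    (Measure.MeasureDense.of_generateFrom_isSetAlgebra_finite (μ := μ + ν) hC hgen).approx A hA
      (measure_ne_top _ _) (ε : ℝ) (by exact_mod_cast hε)
  rw [Measure.add_apply, ENNReal.ofReal_coe_nnreal] at hAB
  have h1 : μ A ≤ μ B + μ (A ∆ B) := by
    refine (measure_mono fun x hx => ?_).trans (measure_union_le _ _)
    by_cases hxB : x ∈ B
    · exact Or.inl hxB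
    · exact Or.inr (Or.inl ⟨hx, hxB⟩)
  have h2 : ν B ≤ ν A + ν (A ∆ B) := by
    refine (measure_mono fun x hx => ?_).trans (measure_union_le _ _)
    by_cases hxA : x ∈ A
    · exact Or.inl hxA
    · exact Or.inr (Or.inr ⟨hx, hxA⟩)
  calc μ A ≤ μ B + μ (A ∆ B) := h1
    _ ≤ ν B + setGap 𝒞 μ ν + μ (A ∆ B) := by gcongr; exact measure_le_add_setGap μ ν hB
    _ ≤ ν A + ν (A ∆ B) + setGap 𝒞 μ ν + μ (A ∆ B) := by gcongr
    _ = ν A + setGap 𝒞 μ ν + (μ (A ∆ B) + ν (A ∆ B)) := by ring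
    _ ≤ ν A + setGap 𝒞 μ ν + ε := by gcongr

lemma tvDist_le_two_mul_setGap {𝒞 : Set (Set E)} (hC : IsSetAlgebra 𝒞)
    (hgen : ‹MeasurableSpace E› = MeasurableSpace.generateFrom 𝒞) (μ ν : Measure E)
    [IsProbabilityMeasure μ] [IsProbabilityMeasure ν] :
    tvDist μ ν ≤ 2 * setGap 𝒞 μ ν := by
  unfold tvDist
  gcongr
  refine iSup₂_le fun A hA => sup_le ?_ ?_
  · exact tsub_le_iff_left.2 (measure_le_add_setGap_of_measurableSet hC hgen μ ν hA)
  · have h := measure_le_add_setGap_of_measurableSet hC hgen μ ν hA.compl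
    have hμ : μ A + μ Aᶜ = 1 := prob_add_prob_compl hA
    have hν : ν A + ν Aᶜ = 1 := prob_add_prob_compl hA
    refine tsub_le_iff_left.2 ((ENNReal.add_le_add_iff_right (measure_ne_top ν Aᶜ)).1 ?_)
    calc ν A + ν Aᶜ = μ A + μ Aᶜ := hν.trans hμ.symm
      _ ≤ μ A + (ν Aᶜ + setGap 𝒞 μ ν) := by gcongr
      _ = μ A + setGap 𝒞 μ ν + ν Aᶜ := by ring

lemma measure_le_add_tvDist (μ ν : Measure E) {A : Set E} (hA : MeasurableSet A) :
    μ A ≤ ν A + tvDist μ ν ∧ ν A ≤ μ A + tvDist μ ν := by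
  have h : (μ A - ν A) ⊔ (ν A - μ A) ≤ tvDist μ ν := by
    unfold tvDist
    refine (le_iSup₂ (f := fun A (_ : MeasurableSet A) => (μ A - ν A) ⊔ (ν A - μ A)) A hA).trans ?_
    exact le_mul_of_one_le_left zero_le one_le_two
  exact ⟨tsub_le_iff_left.1 (le_sup_left.trans h), tsub_le_iff_left.1 (le_sup_right.trans h)⟩

lemma tendsto_measure_of_tendsto_tvDist {μ : ℕ → Measure E} {ν : Measure E} [IsFiniteMeasure ν]
    (h : Tendsto (fun n => tvDist (μ n) ν) atTop (nhds 0)) {A : Set E} (hA : MeasurableSet A) :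
    Tendsto (fun n => μ n A) atTop (nhds (ν A)) := by
  refine tendsto_of_tendsto_of_tendsto_of_le_of_le
    (g := fun n => ν A - tvDist (μ n) ν) (h := fun n => ν A + tvDist (μ n) ν) ?_ ?_
    (fun n => tsub_le_iff_right.2 (measure_le_add_tvDist _ _ hA).2)
    (fun n => (measure_le_add_tvDist _ _ hA).1)
  · simpa using ENNReal.Tendsto.sub tendsto_const_nhds h (Or.inl (measure_ne_top ν A))
  · simpa using tendsto_const_nhds.add h

/-- A Markov kernel contracts the gap between two measures, the common part `ρ` of which does not
contribute. -/
lemma mul_setGap_comp_le {𝒞 : Set (Set E)} (h𝒞 : 𝒞.Countable)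
    (hm : ∀ A ∈ 𝒞, MeasurableSet A) (Q : Kernel E E) {α β ρ : Measure E}
    [IsFiniteMeasure α] [IsFiniteMeasure β] (hαβ : α Set.univ = β Set.univ) :
    α Set.univ * setGap 𝒞 (Q ∘ₘ (α + ρ)) (Q ∘ₘ (β + ρ)) ≤
      ∫⁻ p, setGap 𝒞 (Q p.1) (Q p.2) ∂(α.prod β) := by
  have hr := measurable_setGap h𝒞 hm Q
  rcases eq_or_ne (α Set.univ) 0 with h0 | h0
  · simp [h0]
  rw [mul_comm, ← ENNReal.le_div_iff_mul_le (Or.inl h0) (Or.inl (measure_ne_top _ _)),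
    setGap_le_iff]
  intro A hA
  have hf := Q.measurable_coe (hm A hA)
  have key : α Set.univ * ∫⁻ u, Q u A ∂α ≤ α Set.univ * ∫⁻ u, Q u A ∂β +
      ∫⁻ p, setGap 𝒞 (Q p.1) (Q p.2) ∂(α.prod β) := by
    have h1 : ∫⁻ p, Q p.1 A ∂(α.prod β) = α Set.univ * ∫⁻ u, Q u A ∂α := by
      rw [lintegral_prod (fun p : E × E => Q p.1 A) (hf.comp measurable_fst).aemeasurable]
      simp only [lintegral_const]
      rw [lintegral_mul_const _ hf, hαβ, mul_comm]
    have h2 : ∫⁻ p, Q p.2 A ∂(α.prod β) = α Set.univ * ∫⁻ u, Q u A ∂β := by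
      rw [lintegral_prod (fun p : E × E => Q p.2 A) (hf.comp measurable_snd).aemeasurable]
      simp [mul_comm]
    rw [← h1, ← h2, ← lintegral_add_right _ hr]
    exact lintegral_mono fun p => measure_le_add_setGap _ _ hA
  rw [Measure.bind_apply (hm A hA) Q.aemeasurable, Measure.bind_apply (hm A hA) Q.aemeasurable,
    lintegral_add_measure, lintegral_add_measure, add_right_comm]
  gcongr
  rw [← ENNReal.mul_le_mul_iff_right h0 (measure_ne_top _ _), mul_add,
    ENNReal.mul_div_cancel h0 (measure_ne_top _ _)]
  exact key

end SetGap

section Subharmonic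

lemma ENNReal.mul_self_add_mul_self_eq {a b : ℝ≥0∞} (ha : a ≠ ∞) (hb : b ≠ ∞) :
    a * a + b * b = 2 * (a * b) + ((a - b) * (a - b) + (b - a) * (b - a)) := by
  rcases le_total a b with h | h
  · obtain ⟨c, rfl⟩ := exists_add_of_le h
    rw [ENNReal.add_sub_cancel_left ha, tsub_eq_zero_of_le h]
    ring
  · obtain ⟨c, rfl⟩ := exists_add_of_le h
    rw [ENNReal.add_sub_cancel_left hb, tsub_eq_zero_of_le h]
    ring

/-- A bounded subharmonic function is almost surely constant along the steps of a stationary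
chain. -/
lemma ae_ae_eq_of_subharmonic {Z : Type*} [MeasurableSpace Z] (m : Measure Z)
    [IsFiniteMeasure m] (K : Kernel Z Z) [IsMarkovKernel K] (hK : K ∘ₘ m = m)
    {D : Z → ℝ≥0∞} (hD : Measurable D) (hD1 : ∀ z, D z ≤ 1)
    (hsub : ∀ z, D z ≤ ∫⁻ w, D w ∂(K z)) :
    ∀ᵐ z ∂m, ∀ᵐ w ∂(K z), D w = D z := by
  have hfin : ∀ z, D z ≠ ∞ := fun z => ne_top_of_le_ne_top one_ne_top (hD1 z)
  set I : ℝ≥0∞ := ∫⁻ z, D z * D z ∂m with hI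
  have hIfin : I ≠ ∞ := by
    refine ne_top_of_le_ne_top (measure_ne_top m Set.univ) ?_
    rw [hI, ← lintegral_one]
    exact lintegral_mono fun z => mul_le_one' (hD1 z) (hD1 z)
  have h1 : Measurable fun p : Z × Z => D p.1 := hD.comp measurable_fst
  have h2 : Measurable fun p : Z × Z => D p.2 := hD.comp measurable_snd
  have h11 : Measurable fun p : Z × Z => D p.1 * D p.1 := h1.mul h1
  have h22 : Measurable fun p : Z × Z => D p.2 * D p.2 := h2.mul h2
  have h12 : Measurable fun p : Z × Z => D p.1 * D p.2 := h1.mul h2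
  have hDD : Measurable fun z => D z * D z := hD.mul hD
  set V : Z × Z → ℝ≥0∞ := fun p =>
    (D p.1 - D p.2) * (D p.1 - D p.2) + (D p.2 - D p.1) * (D p.2 - D p.1) with hV
  have hVm : Measurable V :=
    ((h1.sub h2).mul (h1.sub h2)).add ((h2.sub h1).mul (h2.sub h1))
  have hfst : ∫⁻ p, D p.1 * D p.1 ∂(m ⊗ₘ K) = I := by
    rw [Measure.lintegral_compProd h11]
    simp [hI]
  have hsnd : ∫⁻ p, D p.2 * D p.2 ∂(m ⊗ₘ K) = I := by
    rw [Measure.lintegral_compProd h22,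
      ← Measure.lintegral_bind K.aemeasurable hDD.aemeasurable, hK]
  have hcross : I ≤ ∫⁻ p, D p.1 * D p.2 ∂(m ⊗ₘ K) := by
    rw [Measure.lintegral_compProd h12]
    refine lintegral_mono fun z => ?_
    change D z * D z ≤ ∫⁻ w, D z * D w ∂(K z)
    rw [lintegral_const_mul _ hD]
    gcongr
    exact hsub z
  have hsum : I + I = 2 * ∫⁻ p, D p.1 * D p.2 ∂(m ⊗ₘ K) + ∫⁻ p, V p ∂(m ⊗ₘ K) := by
    rw [← lintegral_const_mul _ h12, ← lintegral_add_right _ hVm]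
    nth_rw 1 [← hfst]
    rw [← hsnd, ← lintegral_add_right _ h22]
    exact lintegral_congr fun p => ENNReal.mul_self_add_mul_self_eq (hfin _) (hfin _)
  have hV0 : ∫⁻ p, V p ∂(m ⊗ₘ K) = 0 := by
    have hle : I + I + ∫⁻ p, V p ∂(m ⊗ₘ K) ≤ I + I + 0 := by
      rw [add_zero]
      nth_rw 2 [hsum]
      rw [← two_mul]
      gcongr
    exact nonpos_iff_eq_zero.1
      ((ENNReal.add_le_add_iff_left (ENNReal.add_ne_top.2 ⟨hIfin, hIfin⟩)).1 hle)
  rw [lintegral_eq_zero_iff hVm] at hV0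
  filter_upwards [Measure.ae_ae_of_ae_compProd hV0] with z hz
  filter_upwards [hz] with w hw
  simp only [hV, Pi.zero_apply, add_eq_zero, mul_self_eq_zero, tsub_eq_zero_iff_le] at hw
  exact le_antisymm hw.2 hw.1

end Subharmonic

section NStep

variable {E : Type*} [MeasurableSpace E] (P : Kernel E E)

instance isMarkovKernel_nStep [IsMarkovKernel P] (n : ℕ) : IsMarkovKernel (nStep P n) := by
  induction n with
  | zero => unfold nStep; infer_instance
  | succ n ih => unfold nStep; infer_instance

lemma nStep_add (n k : ℕ) : nStep P (n + k) = nStep P k ∘ₖ nStep P n := by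
  induction n with
  | zero => simp [nStep]
  | succ n ih => rw [Nat.add_right_comm, nStep, ih, nStep, Kernel.comp_assoc]

lemma nStep_add_apply (n k : ℕ) (x : E) : nStep P (n + k) x = nStep P k ∘ₘ nStep P n x := by
  rw [nStep_add, Kernel.comp_apply]

lemma nStep_comp_of_invariant {μ : Measure E} (h : P ∘ₘ μ = μ) (n : ℕ) :
    nStep P n ∘ₘ μ = μ := by
  induction n with
  | zero => simp [nStep]
  | succ n ih => rw [nStep, ← Measure.comp_assoc, h, ih]

lemma comp_eq_of_forall_measure_eq {μ : Measure E}
    (h : ∀ A : Set E, MeasurableSet A → μ A = ∫⁻ x, P x A ∂μ) : P ∘ₘ μ = μ := by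
  ext A hA
  rw [Measure.bind_apply hA P.aemeasurable, ← h A hA]

lemma parallelComp_comp_prod_self (Q : Kernel E E) [IsMarkovKernel Q] {μ : Measure E}
    [IsProbabilityMeasure μ] (h : Q ∘ₘ μ = μ) : (Q ∥ₖ Q) ∘ₘ (μ.prod μ) = μ.prod μ := by
  have hQ : Q ∥ₖ Q = (Q ∥ₖ Kernel.id) ∘ₖ (Kernel.id ∥ₖ Q) := by
    rw [Kernel.parallelComp_comp_parallelComp, Kernel.comp_id, Kernel.id_comp]
  rw [hQ, ← Measure.comp_assoc, ← Measure.prod_comp_right, h, ← Measure.prod_comp_left, h]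

/-- The upper limit of the gaps between the `n`-step transition probabilities. -/
noncomputable def limsupGap (𝒞 : Set (Set E)) (p : E × E) : ℝ≥0∞ :=
  limsup (fun n => setGap 𝒞 (nStep P n p.1) (nStep P n p.2)) atTop

variable {P} {𝒞 : Set (Set E)}

lemma measurable_limsupGap (h𝒞 : 𝒞.Countable) (hm : ∀ A ∈ 𝒞, MeasurableSet A) :
    Measurable (limsupGap P 𝒞) :=
  Measurable.limsup fun n => measurable_setGap h𝒞 hm (nStep P n)

variable [IsMarkovKernel P]

lemma limsupGap_le_one (p : E × E) : limsupGap P 𝒞 p ≤ 1 :=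
  limsup_le_of_le (h := Eventually.of_forall fun _ => setGap_le_one _ _ _)

lemma limsup_lintegral_setGap_le (h𝒞 : 𝒞.Countable) (hm : ∀ A ∈ 𝒞, MeasurableSet A)
    {Y : Type*} [MeasurableSpace Y] {m : Measure Y} [IsFiniteMeasure m] {g : Y → E × E}
    (hg : Measurable g) :
    limsup (fun n => ∫⁻ y, setGap 𝒞 (nStep P n (g y).1) (nStep P n (g y).2) ∂m) atTop ≤
      ∫⁻ y, limsupGap P 𝒞 (g y) ∂m :=
  limsup_lintegral_le (fun _ => 1) (fun n => (measurable_setGap h𝒞 hm (nStep P n)).comp hg)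
    (fun n => Eventually.of_forall fun _ => setGap_le_one _ _ _) (by simp)

lemma mul_limsupGap_le (h𝒞 : 𝒞.Countable) (hm : ∀ A ∈ 𝒞, MeasurableSet A) {n : ℕ} {p : E × E}
    {α β ρ : Measure E} [IsFiniteMeasure α] [IsFiniteMeasure β]
    (hαβ : α Set.univ = β Set.univ) (h1 : nStep P n p.1 = α + ρ) (h2 : nStep P n p.2 = β + ρ) :
    α Set.univ * limsupGap P 𝒞 p ≤ ∫⁻ q, limsupGap P 𝒞 q ∂(α.prod β) := by
  rw [limsupGap, ← limsup_nat_add _ n, ← ENNReal.limsup_const_mul_of_ne_top (measure_ne_top _ _)]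
  refine le_trans ?_ (limsup_lintegral_setGap_le h𝒞 hm measurable_id)
  refine limsup_le_limsup (Eventually.of_forall fun k => ?_)
  simp only [add_comm k n, nStep_add_apply, h1, h2]
  exact mul_setGap_comp_le h𝒞 hm (nStep P k) hαβ

lemma limsupGap_le_lintegral (h𝒞 : 𝒞.Countable) (hm : ∀ A ∈ 𝒞, MeasurableSet A) (n : ℕ)
    (p : E × E) :
    limsupGap P 𝒞 p ≤ ∫⁻ q, limsupGap P 𝒞 q ∂((nStep P n ∥ₖ nStep P n) p) := by
  rw [Kernel.parallelComp_apply]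
  simpa using mul_limsupGap_le (P := P) h𝒞 hm (n := n) (p := p) (ρ := 0) (by simp)
    (add_zero _).symm (add_zero _).symm

/-- If the transition probabilities from the two coordinates of `p` overlap at time `n`, and
`limsupGap` does not change along `n` steps from `p`, then it vanishes at `p`. -/
lemma limsupGap_eq_zero (h𝒞 : 𝒞.Countable) (hm : ∀ A ∈ 𝒞, MeasurableSet A) {n : ℕ} {p : E × E}
    (hns : ¬ nStep P n p.1 ⟂ₘ nStep P n p.2)
    (hconst : ∀ᵐ q ∂((nStep P n ∥ₖ nStep P n) p), limsupGap P 𝒞 q = limsupGap P 𝒞 p) :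
    limsupGap P 𝒞 p = 0 := by
  rw [Measure.mutuallySingular_iff_disjoint, disjoint_iff] at hns
  set ρ := nStep P n p.1 ⊓ nStep P n p.2
  have hρ1 : ρ ≤ nStep P n p.1 := inf_le_left
  have hρ2 : ρ ≤ nStep P n p.2 := inf_le_right
  have hρ0 : ρ Set.univ ≠ 0 := fun h => hns (Measure.measure_univ_eq_zero.1 h)
  have : IsFiniteMeasure ρ := isFiniteMeasure_of_le _ hρ1
  set α := nStep P n p.1 - ρ
  set β := nStep P n p.2 - ρ
  have h1 : α + ρ = nStep P n p.1 := Measure.sub_add_cancel_of_le hρ1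
  have h2 : β + ρ = nStep P n p.2 := Measure.sub_add_cancel_of_le hρ2
  have hα : α ≤ nStep P n p.1 := Measure.sub_le
  have hβ : β ≤ nStep P n p.2 := Measure.sub_le
  have : IsFiniteMeasure α := isFiniteMeasure_of_le _ hα
  have : IsFiniteMeasure β := isFiniteMeasure_of_le _ hβ
  have hα1 : α Set.univ + ρ Set.univ = 1 := by
    rw [← Measure.add_apply, h1, measure_univ]
  have hβ1 : β Set.univ + ρ Set.univ = 1 := by
    rw [← Measure.add_apply, h2, measure_univ]
  have hαβ : α Set.univ = β Set.univ :=
    (ENNReal.add_left_inj (measure_ne_top ρ _)).1 (hα1.trans hβ1.symm)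
  rcases eq_or_ne (α Set.univ) 0 with h0 | h0
  · have hβ0 : β = 0 := Measure.measure_univ_eq_zero.1 (hαβ ▸ h0)
    have hα0 : α = 0 := Measure.measure_univ_eq_zero.1 h0
    have heq : nStep P n p.1 = nStep P n p.2 := by rw [← h1, ← h2, hα0, hβ0]
    rw [limsupGap, ← limsup_nat_add _ n]
    simp [add_comm _ n, nStep_add_apply, heq, setGap_self]
  have hac : α.prod β ≪ (nStep P n ∥ₖ nStep P n) p := by
    rw [Kernel.parallelComp_apply]
    exact (Measure.absolutelyContinuous_of_le hα).prod (Measure.absolutelyContinuous_of_le hβ)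
  have hle := mul_limsupGap_le (P := P) h𝒞 hm hαβ h1.symm h2.symm
  rw [lintegral_congr_ae (hac.ae_le hconst), lintegral_const, ← Set.univ_prod_univ,
    Measure.prod_prod, ← hαβ, mul_left_comm,
    ENNReal.mul_le_mul_iff_right h0 (measure_ne_top _ _)] at hle
  have hD : limsupGap P 𝒞 p ≠ ∞ := ne_top_of_le_ne_top one_ne_top (limsupGap_le_one p)
  have hzero : limsupGap P 𝒞 p * ρ Set.univ ≤ 0 := by
    refine (ENNReal.add_le_add_iff_left (ENNReal.mul_ne_top hD (measure_ne_top α Set.univ))).1 ?_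
    rwa [← mul_add, hα1, mul_one, add_zero]
  exact (mul_eq_zero.1 (nonpos_iff_eq_zero.1 hzero)).resolve_right hρ0

lemma ae_limsupGap_eq_zero (h𝒞 : 𝒞.Countable) (hm : ∀ A ∈ 𝒞, MeasurableSet A)
    (hns : ∀ x y : E, ∃ n : ℕ, ¬ nStep P n x ⟂ₘ nStep P n y) {μ : Measure E}
    [IsProbabilityMeasure μ] (hμ : P ∘ₘ μ = μ) :
    ∀ᵐ p ∂(μ.prod μ), limsupGap P 𝒞 p = 0 := by
  have hconst : ∀ᵐ p ∂(μ.prod μ), ∀ n : ℕ,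
      ∀ᵐ q ∂((nStep P n ∥ₖ nStep P n) p), limsupGap P 𝒞 q = limsupGap P 𝒞 p :=
    ae_all_iff.2 fun n => ae_ae_eq_of_subharmonic _ _
      (parallelComp_comp_prod_self _ (nStep_comp_of_invariant P hμ n))
      (measurable_limsupGap h𝒞 hm) limsupGap_le_one (limsupGap_le_lintegral h𝒞 hm n)
  filter_upwards [hconst] with p hp
  obtain ⟨n, hn⟩ := hns p.1 p.2
  exact limsupGap_eq_zero h𝒞 hm hn (hp n)

lemma setGap_le_lintegral_of_invariant (hm : ∀ A ∈ 𝒞, MeasurableSet A)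
    (Q : Kernel E E) {μ : Measure E} [IsProbabilityMeasure μ] (hμ : Q ∘ₘ μ = μ) (x : E) :
    setGap 𝒞 (Q x) μ ≤ ∫⁻ y, setGap 𝒞 (Q x) (Q y) ∂μ := by
  refine setGap_le_iff.2 fun A hA => ?_
  have hμA : μ A = ∫⁻ y, Q y A ∂μ := by
    conv_lhs => rw [← hμ, Measure.bind_apply (hm A hA) Q.aemeasurable]
  rw [hμA, ← lintegral_add_left (Q.measurable_coe (hm A hA))]
  calc Q x A = ∫⁻ _, Q x A ∂μ := by simp
    _ ≤ _ := lintegral_mono fun y => measure_le_add_setGap _ _ hA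

/-- Convergence in total variation to an invariant probability measure. -/
theorem ae_tendsto_tvDist_nStep [MeasurableSpace.CountablyGenerated E]
    (hns : ∀ x y : E, ∃ n : ℕ, ¬ nStep P n x ⟂ₘ nStep P n y) {μ : Measure E}
    [IsProbabilityMeasure μ] (hμ : P ∘ₘ μ = μ) :
    ∀ᵐ x ∂μ, Tendsto (fun n => tvDist (nStep P n x) μ) atTop (nhds 0) := by
  set 𝒞 : Set (Set E) := generateSetAlgebra (MeasurableSpace.countableGeneratingSet E) with h𝒞def
  have hC : IsSetAlgebra 𝒞 := isSetAlgebra_generateSetAlgebra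
  have h𝒞 : 𝒞.Countable :=
    countable_generateSetAlgebra MeasurableSpace.countable_countableGeneratingSet
  have hgen : ‹MeasurableSpace E› = MeasurableSpace.generateFrom 𝒞 := by
    rw [h𝒞def, generateFrom_generateSetAlgebra_eq,
      MeasurableSpace.generateFrom_countableGeneratingSet]
  have hm : ∀ A ∈ 𝒞, MeasurableSet A := fun A hA => by
    rw [hgen]
    exact MeasurableSpace.measurableSet_generateFrom hA
  filter_upwards [Measure.ae_ae_of_ae_prod (ae_limsupGap_eq_zero h𝒞 hm hns hμ)] with x hx
  have hlim : Tendsto (fun n => ∫⁻ y, setGap 𝒞 (nStep P n x) (nStep P n y) ∂μ) atTop (nhds 0) := by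
    refine tendsto_of_le_liminf_of_limsup_le zero_le ?_
    refine (limsup_lintegral_setGap_le (g := fun y => (x, y)) h𝒞 hm measurable_prodMk_left).trans ?_
    rw [lintegral_congr_ae hx, lintegral_zero]
  refine tendsto_of_tendsto_of_tendsto_of_le_of_le tendsto_const_nhds
    (h := fun n => 2 * ∫⁻ y, setGap 𝒞 (nStep P n x) (nStep P n y) ∂μ) ?_ (fun _ => zero_le)
    fun n => (tvDist_le_two_mul_setGap hC hgen _ _).trans ?_
  · simpa using ENNReal.Tendsto.const_mul hlim (Or.inr ofNat_ne_top)
  · dsimp only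
    gcongr
    exact setGap_le_lintegral_of_invariant hm _ (nStep_comp_of_invariant P hμ n) x

/-- An invariant probability measure is the only invariant probability measure absolutely
continuous with respect to it, provided the chain converges to it almost everywhere. -/
lemma eq_of_ae_tendsto_tvDist {μ ν : Measure E} [IsProbabilityMeasure μ] [IsProbabilityMeasure ν]
    (hν : P ∘ₘ ν = ν) (hac : ν ≪ μ)
    (h : ∀ᵐ x ∂μ, Tendsto (fun n => tvDist (nStep P n x) μ) atTop (nhds 0)) : ν = μ := by
  ext A hA
  have hlim : Tendsto (fun n => ∫⁻ x, nStep P n x A ∂ν) atTop (nhds (∫⁻ _, μ A ∂ν)) :=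
    tendsto_lintegral_of_dominated_convergence (fun _ => 1)
      (fun n => (nStep P n).measurable_coe hA)
      (fun n => Eventually.of_forall fun _ => prob_le_one) (by simp)
      (Eventually.mono (hac.ae_le h) fun _ hx => tendsto_measure_of_tendsto_tvDist hx hA)
  have hconst : ∀ n, ∫⁻ x, nStep P n x A ∂ν = ν A := fun n => by
    rw [← Measure.bind_apply hA (nStep P n).aemeasurable, nStep_comp_of_invariant P hν n]
  simp only [hconst, lintegral_const, measure_univ, mul_one] at hlim
  exact tendsto_nhds_unique tendsto_const_nhds hlim

end NStep

/-- **Corollary 1.** If for every pair `x, y` there is `n` with `P_n(x,·)` and `P_n(y,·)`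
not mutually singular, then the chain has at most one invariant probability measure, and
if an invariant probability measure `μ` exists then `‖P_n(x,·) - μ‖ → 0` for `μ`-a.a. `x`. -/
theorem doob_nonsingular_unique
    {E : Type*} [MeasurableSpace E] [MeasurableSpace.CountablyGenerated E]
    (hΔ : MeasurableSet {p : E × E | p.1 = p.2})
    (P : ProbabilityTheory.Kernel E E) [IsMarkovKernel P]
    (hns : ∀ x y : E, ∃ n : ℕ, ¬ nStep P n x ⟂ₘ nStep P n y) :
    (∀ μ₁ μ₂ : Measure E, IsProbabilityMeasure μ₁ → IsProbabilityMeasure μ₂ →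
      (∀ A : Set E, MeasurableSet A → μ₁ A = ∫⁻ x, P x A ∂μ₁) →
      (∀ A : Set E, MeasurableSet A → μ₂ A = ∫⁻ x, P x A ∂μ₂) → μ₁ = μ₂) ∧
    (∀ μ : Measure E, IsProbabilityMeasure μ →
      (∀ A : Set E, MeasurableSet A → μ A = ∫⁻ x, P x A ∂μ) →
      ∀ᵐ x ∂μ, Tendsto (fun n => tvDist (nStep P n x) μ) atTop (nhds 0)) := by
  refine ⟨fun μ₁ μ₂ h₁ h₂ hinv₁ hinv₂ => ?_, fun μ _ hinv =>
    ae_tendsto_tvDist_nStep hns (comp_eq_of_forall_measure_eq P hinv)⟩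
  have hP₁ := comp_eq_of_forall_measure_eq P hinv₁
  have hP₂ := comp_eq_of_forall_measure_eq P hinv₂
  set μ : Measure E := (2⁻¹ : ℝ≥0∞) • (μ₁ + μ₂) with hμdef
  have h2 : (2⁻¹ : ℝ≥0∞) ≠ 0 := ENNReal.inv_ne_zero.2 ofNat_ne_top
  have hμ : P ∘ₘ μ = μ := by
    rw [hμdef, Measure.comp_smul, Measure.comp_add, hP₁, hP₂]
  have : IsProbabilityMeasure μ := ⟨by
    simp only [hμdef, Measure.smul_apply, Measure.add_apply, measure_univ, smul_eq_mul,
      one_add_one_eq_two]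
    exact ENNReal.inv_mul_cancel two_ne_zero ofNat_ne_top⟩
  have hlim := ae_tendsto_tvDist_nStep hns hμ
  have hac : μ₁ + μ₂ ≪ μ := Measure.absolutelyContinuous_smul h2
  rw [eq_of_ae_tendsto_tvDist hP₁ (Measure.AbsolutelyContinuous.trans
      (Measure.absolutelyContinuous_of_le (Measure.le_add_right le_rfl)) hac) hlim,
    eq_of_ae_tendsto_tvDist hP₂ (Measure.AbsolutelyContinuous.trans
      (Measure.absolutelyContinuous_of_le (Measure.le_add_left le_rfl)) hac) hlim]
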